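/- The fundamental solution Γ of the principal Kolmogorov operator is homogeneous of degree −Q with respect to the dilations: Γ(δ_r z, 0) = r^{−Q} Γ(z, 0) for every z ∈ ℝ^{N+1} \ {0} and every r > 0, where Q = m₀ + 3m₁ + … + (2κ+1)m_κ. -/

import Mathlib

open MeasureTheory

noncomputable section

abbrev KSpace (N : ℕ) : Type := (Fin N → ℝ) × ℝ

/-- `E(s) = exp(-s B)`, defined by the exponential power series. -/
noncomputable def Emat {N : ℕ} (B : Matrix (Fin N) (Fin N) ℝ) (s : ℝ) :
    Matrix (Fin N) (Fin N) ℝ :=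
  ∑' n : ℕ, ((n.factorial : ℝ)⁻¹) • ((-s) • B) ^ n

/-- The group law `(x,t)∘(ξ,τ) = (ξ + E(τ)x, t+τ)`; `grpMul B z w = z ∘ w`. -/
def grpMul {N : ℕ} (B : Matrix (Fin N) (Fin N) ℝ) (z w : KSpace N) : KSpace N :=
  (w.1 + (Emat B w.2).mulVec z.1, z.2 + w.2)

/-- The candidate inverse `(x,t)⁻¹ = (-E(-t)x, -t)`. -/
def grpInv {N : ℕ} (B : Matrix (Fin N) (Fin N) ℝ) (z : KSpace N) : KSpace N :=
  (-(Emat B (-z.2)).mulVec z.1, -z.2)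

/-- Partial sums of block sizes: `offsetSum m j = m 0 + ⋯ + m (j-1)`. -/
def offsetSum (m : ℕ → ℕ) (j : ℕ) : ℕ := ∑ l ∈ Finset.range j, m l

/-- Index of the block containing coordinate `i`. -/
def blkIdx (κ : ℕ) (m : ℕ → ℕ) (i : ℕ) : ℕ :=
  Nat.findGreatest (fun j => offsetSum m j ≤ i) κ

/-- The dilation exponent of coordinate `i`: `α_i = 2j+1` when `i` lies in block `j`. -/
def alphaExp (κ : ℕ) (m : ℕ → ℕ) (i : ℕ) : ℕ := 2 * blkIdx κ m i + 1

/-- The spatial homogeneous dimension `Q = m₀ + 3 m₁ + ⋯ + (2κ+1) m_κ`. -/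
def homDim (κ : ℕ) (m : ℕ → ℕ) : ℕ := ∑ j ∈ Finset.range (κ + 1), (2 * j + 1) * m j

/-- `B` is in canonical form with blocks `m 0 ≥ m 1 ≥ … ≥ m κ ≥ 1` summing to `N`:
its only nonzero entries lie in blocks `B_j` (of size `m j × m (j-1)`) just below
the diagonal blocks, and each such block has rank `m j`. -/
def IsCanonical (N κ : ℕ) (m : ℕ → ℕ) (B : Matrix (Fin N) (Fin N) ℝ) : Prop :=
  (∀ j, j ≤ κ → 1 ≤ m j) ∧
  (∀ j, j < κ → m (j + 1) ≤ m j) ∧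
  (∑ j ∈ Finset.range (κ + 1), m j = N) ∧
  (∀ i i' : Fin N, B i i' ≠ 0 → blkIdx κ m (i : ℕ) = blkIdx κ m (i' : ℕ) + 1) ∧
  (∀ j, 1 ≤ j → j ≤ κ →
    (Matrix.of fun a b : Fin N =>
        if blkIdx κ m (a : ℕ) = j ∧ blkIdx κ m (b : ℕ) = j - 1 then B a b else 0).rank = m j)

/-- The dilation `δ_r` acting on `ℝ^{N+1}`. -/
def dil {N : ℕ} (κ : ℕ) (m : ℕ → ℕ) (r : ℝ) (z : KSpace N) : KSpace N :=
  (fun i => r ^ alphaExp κ m (i : ℕ) * z.1 i, r ^ 2 * z.2)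

/-- The unit cylinder `Q₁ = B₁ × ⋯ × B₁ × (-1,0)`, one Euclidean unit ball per block. -/
def unitCyl (N κ : ℕ) (m : ℕ → ℕ) : Set (KSpace N) :=
  {z | (∀ j, j ≤ κ → (∑ i : Fin N, if blkIdx κ m (i : ℕ) = j then z.1 i ^ 2 else 0) < 1) ∧
    z.2 ∈ Set.Ioo (-1 : ℝ) 0}

/-- The cylinder `Q_r(z₀) = z₀ ∘ δ_r(Q₁)`. -/
def cyl {N : ℕ} (B : Matrix (Fin N) (Fin N) ℝ) (κ : ℕ) (m : ℕ → ℕ) (r : ℝ) (z₀ : KSpace N) :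
    Set (KSpace N) :=
  (fun w => grpMul B z₀ (dil κ m r w)) '' unitCyl N κ m

/-- The delayed cylinder `Q̄_r^m(z₀) = ((0,…,0,m r²) ∘ Q_r(z₀)) ∩ (ℝ^N × (t₀,∞))`. -/
def delayedCyl {N : ℕ} (B : Matrix (Fin N) (Fin N) ℝ) (κ : ℕ) (m : ℕ → ℕ) (mm : ℕ) (r : ℝ)
    (z₀ : KSpace N) : Set (KSpace N) :=
  ((fun w => grpMul B ((0 : Fin N → ℝ), (mm : ℝ) * r ^ 2) w) '' cyl B κ m r z₀) ∩
    {z : KSpace N | z₀.2 < z.2}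

/-- The stacked cylinder `kQ_r(z₀) = (0,…,0,(k²-1)r²/2) ∘ Q_{kr}(z₀)`. -/
def stackedCyl {N : ℕ} (B : Matrix (Fin N) (Fin N) ℝ) (κ : ℕ) (m : ℕ → ℕ) (k : ℕ) (r : ℝ)
    (z₀ : KSpace N) : Set (KSpace N) :=
  (fun w => grpMul B ((0 : Fin N → ℝ), (((k : ℝ) ^ 2 - 1) / 2) * r ^ 2) w) ''
    cyl B κ m ((k : ℝ) * r) z₀

/-- The `i`-th spatial unit direction in `ℝ^{N+1}`. -/
def eSpat (N : ℕ) (i : Fin N) : KSpace N := (Pi.single i 1, 0)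

/-- The time direction in `ℝ^{N+1}`. -/
def eTime (N : ℕ) : KSpace N := (0, 1)

/-- The principal Kolmogorov operator
`K u = Σ_{i<m₀} ∂²_{x_i} u + ⟨Bx, Du⟩ - ∂_t u`. -/
def Kop {N : ℕ} (m₀ : ℕ) (B : Matrix (Fin N) (Fin N) ℝ) (u : KSpace N → ℝ) (z : KSpace N) : ℝ :=
  (∑ i : Fin N, if (i : ℕ) < m₀ then
      fderiv ℝ (fun w => fderiv ℝ u w (eSpat N i)) z (eSpat N i) else 0)
    + (∑ i : Fin N, B.mulVec z.1 i * fderiv ℝ u z (eSpat N i))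
    - fderiv ℝ u z (eTime N)

/-- The drift operator `Y u = ⟨Bx, Du⟩ - ∂_t u`. -/
def Yop {N : ℕ} (B : Matrix (Fin N) (Fin N) ℝ) (u : KSpace N → ℝ) (z : KSpace N) : ℝ :=
  (∑ i : Fin N, B.mulVec z.1 i * fderiv ℝ u z (eSpat N i)) - fderiv ℝ u z (eTime N)

/-- The matrix `A₀` with identity top-left `m₀ × m₀` block and zeros elsewhere. -/
def A0mat (N m₀ : ℕ) : Matrix (Fin N) (Fin N) ℝ :=
  Matrix.of fun i j : Fin N => if (i : ℕ) < m₀ ∧ i = j then 1 else 0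

/-- `C(t) = ∫₀ᵗ E(s) A₀ E(s)ᵀ ds`, entrywise. -/
def Cmat {N : ℕ} (B : Matrix (Fin N) (Fin N) ℝ) (m₀ : ℕ) (t : ℝ) : Matrix (Fin N) (Fin N) ℝ :=
  Matrix.of fun i j : Fin N => ∫ s in (0:ℝ)..t, (Emat B s * A0mat N m₀ * (Emat B s).transpose) i j

/-- The fundamental solution `Γ((x,t),(0,0))`. -/
def fundSol {N : ℕ} (B : Matrix (Fin N) (Fin N) ℝ) (m₀ : ℕ) (z : KSpace N) : ℝ :=
  if 0 < z.2 then
    (4 * Real.pi) ^ (-(N : ℝ) / 2) * (Cmat B m₀ z.2).det ^ (-(1 : ℝ) / 2) *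
      Real.exp (-(1/4) * (∑ i : Fin N, ((Cmat B m₀ z.2)⁻¹).mulVec z.1 i * z.1 i)
        - z.2 * B.trace)
  else 0

/-- The two-point fundamental solution `Γ(z,ζ) = Γ(ζ⁻¹ ∘ z, 0)`. -/
def fundSol2 {N : ℕ} (B : Matrix (Fin N) (Fin N) ℝ) (m₀ : ℕ) (z ζ : KSpace N) : ℝ :=
  fundSol B m₀ (grpMul B (grpInv B ζ) z)

/-- The homogeneous norm: `‖z‖` is the unique `r > 0` with
`Σ_i x_i²/r^{2α_i} + t²/r⁴ = 1` (and `‖0‖ = 0`); realized as an infimum. -/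
def homNorm {N : ℕ} (κ : ℕ) (m : ℕ → ℕ) (z : KSpace N) : ℝ :=
  sInf {r : ℝ | 0 < r ∧
    (∑ i : Fin N, z.1 i ^ 2 / r ^ (2 * alphaExp κ m (i : ℕ))) + z.2 ^ 2 / r ^ 4 = 1}

end

/-- The spatial part of the dilation `δ_r`, as a diagonal matrix. -/
def dilMat (N κ : ℕ) (m : ℕ → ℕ) (r : ℝ) : Matrix (Fin N) (Fin N) ℝ :=
  Matrix.diagonal fun i : Fin N => r ^ alphaExp κ m (i : ℕ)

lemma offsetSum_mono (m : ℕ → ℕ) : Monotone (offsetSum m) := fun _ _ h =>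
  Finset.sum_le_sum_of_subset (Finset.range_mono h)

lemma offsetSum_succ (m : ℕ → ℕ) (j : ℕ) : offsetSum m (j + 1) = offsetSum m j + m j :=
  Finset.sum_range_succ m j

lemma blkIdx_eq {κ : ℕ} {m : ℕ → ℕ} {i j : ℕ} (hj : j ≤ κ) (h₁ : offsetSum m j ≤ i)
    (h₂ : i < offsetSum m (j + 1)) : blkIdx κ m i = j := by
  rw [blkIdx, Nat.findGreatest_eq_iff]
  exact ⟨hj, fun _ => h₁, fun {n} hn _ h => absurd h (not_le.2 (h₂.trans_le (offsetSum_mono m hn)))⟩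

lemma alphaExp_of_lt {κ : ℕ} {m : ℕ → ℕ} {i : ℕ} (h : i < m 0) : alphaExp κ m i = 1 := by
  rw [alphaExp, blkIdx_eq (j := 0) (Nat.zero_le _) (by simp [offsetSum])
    (by simpa [offsetSum] using h)]

lemma sum_alphaExp_range_offsetSum (κ : ℕ) (m : ℕ → ℕ) {J : ℕ} (hJ : J ≤ κ + 1) :
    ∑ i ∈ Finset.range (offsetSum m J), alphaExp κ m i =
      ∑ j ∈ Finset.range J, (2 * j + 1) * m j := by
  induction J with
  | zero => simp [offsetSum]
  | succ J ih =>
    have hblk : ∀ x ∈ Finset.range (m J), alphaExp κ m (offsetSum m J + x) = 2 * J + 1 := by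
      intro x hx
      have hx' := Finset.mem_range.1 hx
      rw [alphaExp, blkIdx_eq (j := J) (by omega) (by omega) (by rw [offsetSum_succ]; omega)]
    rw [offsetSum_succ, Finset.sum_range_add, ih (by omega), Finset.sum_range_succ,
      Finset.sum_congr rfl hblk]
    simp [mul_comm]

lemma det_dilMat {N κ : ℕ} {m : ℕ → ℕ} (hN : ∑ j ∈ Finset.range (κ + 1), m j = N) (r : ℝ) :
    (dilMat N κ m r).det = r ^ homDim κ m := by
  rw [dilMat, Matrix.det_diagonal, Finset.prod_pow_eq_pow_sum,
    Fin.sum_univ_eq_sum_range (fun i => alphaExp κ m i) N, ← hN]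
  exact congrArg _ (sum_alphaExp_range_offsetSum κ m le_rfl)

lemma isUnit_dilMat (N κ : ℕ) (m : ℕ → ℕ) {r : ℝ} (hr : r ≠ 0) : IsUnit (dilMat N κ m r) := by
  rw [Matrix.isUnit_iff_isUnit_det, dilMat, Matrix.det_diagonal, isUnit_iff_ne_zero]
  exact Finset.prod_ne_zero_iff.2 fun i _ => pow_ne_zero _ hr

lemma Emat_eq_exp {N : ℕ} (B : Matrix (Fin N) (Fin N) ℝ) (s : ℝ) :
    Emat B s = NormedSpace.exp ((-s) • B) := by
  rw [NormedSpace.exp_eq_tsum ℝ]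
  rfl

lemma dilMat_mul_eq {N κ : ℕ} {m : ℕ → ℕ} {B : Matrix (Fin N) (Fin N) ℝ}
    (hB : ∀ i i' : Fin N, B i i' ≠ 0 → blkIdx κ m (i : ℕ) = blkIdx κ m (i' : ℕ) + 1) (r : ℝ) :
    dilMat N κ m r * B = (r ^ 2) • (B * dilMat N κ m r) := by
  ext i j
  simp only [dilMat, Matrix.diagonal_mul, Matrix.smul_apply, Matrix.mul_diagonal, smul_eq_mul]
  by_cases h : B i j = 0
  · simp [h]
  · rw [alphaExp, alphaExp, hB i j h]
    ring

lemma Emat_sq_mul {N κ : ℕ} {m : ℕ → ℕ} {B : Matrix (Fin N) (Fin N) ℝ}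
    (hB : ∀ i i' : Fin N, B i i' ≠ 0 → blkIdx κ m (i : ℕ) = blkIdx κ m (i' : ℕ) + 1)
    {r : ℝ} (hr : r ≠ 0) (s : ℝ) :
    Emat B (r ^ 2 * s) = dilMat N κ m r * Emat B s * (dilMat N κ m r)⁻¹ := by
  have hD := isUnit_dilMat N κ m hr
  rw [Emat_eq_exp, Emat_eq_exp, ← Matrix.exp_conj _ _ hD]
  congr 1
  rw [Matrix.mul_smul, dilMat_mul_eq hB, Matrix.smul_mul, Matrix.smul_mul,
    Matrix.mul_nonsing_inv_cancel_right _ _ ((Matrix.isUnit_iff_isUnit_det _).1 hD), smul_smul]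
  congr 1
  ring

lemma dilMat_mul_A0mat_mul (N κ : ℕ) (m : ℕ → ℕ) (r : ℝ) :
    dilMat N κ m r * A0mat N (m 0) * dilMat N κ m r = (r ^ 2) • A0mat N (m 0) := by
  ext i j
  simp only [dilMat, Matrix.diagonal_mul, Matrix.mul_diagonal, Matrix.smul_apply, A0mat,
    Matrix.of_apply, smul_eq_mul]
  by_cases h : (i : ℕ) < m 0 ∧ i = j
  · obtain ⟨h, rfl⟩ := h
    simp [h, alphaExp_of_lt h, sq]
  · simp [h]

lemma dilMat_transpose (N κ : ℕ) (m : ℕ → ℕ) (r : ℝ) :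
    (dilMat N κ m r).transpose = dilMat N κ m r := Matrix.diagonal_transpose _

lemma Cmat_sq_mul {N κ : ℕ} {m : ℕ → ℕ} {B : Matrix (Fin N) (Fin N) ℝ}
    (hB : ∀ i i' : Fin N, B i i' ≠ 0 → blkIdx κ m (i : ℕ) = blkIdx κ m (i' : ℕ) + 1)
    {r : ℝ} (hr : r ≠ 0) (t : ℝ) :
    Cmat B (m 0) (r ^ 2 * t) = dilMat N κ m r * Cmat B (m 0) t * dilMat N κ m r := by
  have hdet := (Matrix.isUnit_iff_isUnit_det _).1 (isUnit_dilMat N κ m hr)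
  have hA : (r ^ 2) • ((dilMat N κ m r)⁻¹ * A0mat N (m 0) * (dilMat N κ m r)⁻¹) =
      A0mat N (m 0) := by
    rw [← Matrix.smul_mul, ← Matrix.mul_smul, ← dilMat_mul_A0mat_mul N κ m r,
      Matrix.mul_assoc (dilMat N κ m r), Matrix.nonsing_inv_mul_cancel_left _ _ hdet,
      Matrix.mul_nonsing_inv_cancel_right _ _ hdet]
  have hint : ∀ s, (r ^ 2) • (Emat B (r ^ 2 * s) * A0mat N (m 0) *
      (Emat B (r ^ 2 * s)).transpose) =
      dilMat N κ m r * (Emat B s * A0mat N (m 0) * (Emat B s).transpose) * dilMat N κ m r := by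
    intro s
    conv_rhs => rw [← hA]
    rw [Emat_sq_mul hB hr]
    simp only [Matrix.transpose_mul, Matrix.transpose_nonsing_inv, dilMat_transpose,
      Matrix.mul_smul, Matrix.smul_mul, Matrix.mul_assoc]
  ext i j
  have hsub := intervalIntegral.smul_integral_comp_mul_left (a := 0) (b := t)
    (fun s => (Emat B s * A0mat N (m 0) * (Emat B s).transpose) i j) (r ^ 2)
  rw [mul_zero] at hsub
  simp only [dilMat, Matrix.diagonal_mul, Matrix.mul_diagonal, Cmat, Matrix.of_apply]
  rw [← hsub, ← intervalIntegral.integral_smul, ← intervalIntegral.integral_const_mul,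
    ← intervalIntegral.integral_mul_const]
  refine intervalIntegral.integral_congr fun s _ => ?_
  have h := congrFun (congrFun (hint s) i) j
  simpa only [dilMat, Matrix.diagonal_mul, Matrix.mul_diagonal, Matrix.smul_apply] using h

lemma trace_eq_zero_of_blkIdx {N κ : ℕ} {m : ℕ → ℕ} {B : Matrix (Fin N) (Fin N) ℝ}
    (hB : ∀ i i' : Fin N, B i i' ≠ 0 → blkIdx κ m (i : ℕ) = blkIdx κ m (i' : ℕ) + 1) :
    B.trace = 0 :=
  Finset.sum_eq_zero fun i _ => by
    by_contra h
    exact absurd (hB i i h) (by omega)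

lemma quadForm_inv_dilMat_conj {N κ : ℕ} {m : ℕ → ℕ} {r : ℝ} (hr : r ≠ 0)
    (C : Matrix (Fin N) (Fin N) ℝ) (x : Fin N → ℝ) :
    ((dilMat N κ m r * C * dilMat N κ m r)⁻¹).mulVec ((dilMat N κ m r).mulVec x) ⬝ᵥ
      (dilMat N κ m r).mulVec x = (C⁻¹).mulVec x ⬝ᵥ x := by
  have hdet := (Matrix.isUnit_iff_isUnit_det _).1 (isUnit_dilMat N κ m hr)
  rw [Matrix.mul_inv_rev, Matrix.mul_inv_rev, Matrix.mulVec_mulVec, Matrix.mul_assoc,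
    Matrix.nonsing_inv_mul_cancel_right _ _ hdet, ← Matrix.mulVec_mulVec,
    Matrix.dotProduct_mulVec, ← Matrix.mulVec_transpose, dilMat_transpose,
    Matrix.mulVec_mulVec, Matrix.mul_nonsing_inv _ hdet, Matrix.one_mulVec]

/-- The fundamental solution `Γ` of the principal Kolmogorov operator is
homogeneous of degree `-Q` with respect to the dilations: `Γ(δ_r z, 0) = r^{-Q} Γ(z,0)` for
every `z ≠ 0` and every `r > 0`. -/
theorem fundamental_solution_homogeneous (N κ : ℕ) (m : ℕ → ℕ) (hN : 1 ≤ N)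
    (B : Matrix (Fin N) (Fin N) ℝ) (hB : IsCanonical N κ m B)
    (hC : ∀ t : ℝ, 0 < t → (Cmat B (m 0) t).PosDef)
    (z : KSpace N) (hz : z ≠ 0) (r : ℝ) (hr : 0 < r) :
    fundSol B (m 0) (dil κ m r z) = (r ^ homDim κ m)⁻¹ * fundSol B (m 0) z := by
  obtain ⟨-, -, hsum, hblk, -⟩ := hB
  have hdil : dil κ m r z = ((dilMat N κ m r).mulVec z.1, r ^ 2 * z.2) :=
    Prod.ext (funext fun i =>
      (Matrix.mulVec_diagonal (fun i : Fin N => r ^ alphaExp κ m (i : ℕ)) z.1 i).symm) rfl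
  by_cases ht : 0 < z.2
  · have hdet : (Cmat B (m 0) (r ^ 2 * z.2)).det ^ (-(1 : ℝ) / 2) =
        (r ^ homDim κ m)⁻¹ * (Cmat B (m 0) z.2).det ^ (-(1 : ℝ) / 2) := by
      have hQ : 0 < r ^ homDim κ m := pow_pos hr _
      rw [Cmat_sq_mul hblk hr.ne', Matrix.det_mul, Matrix.det_mul, det_dilMat hsum,
        mul_right_comm, ← sq, Real.mul_rpow (sq_nonneg _) (hC _ ht).det_pos.le,
        ← Real.rpow_natCast (r ^ homDim κ m) 2, ← Real.rpow_mul hQ.le,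
        ← Real.rpow_neg_one (r ^ homDim κ m)]
      norm_num
    have hquad := quadForm_inv_dilMat_conj (κ := κ) (m := m) hr.ne' (Cmat B (m 0) z.2) z.1
    rw [← Cmat_sq_mul hblk hr.ne'] at hquad
    simp only [dotProduct] at hquad
    rw [hdil, fundSol, fundSol, if_pos ht, if_pos (by positivity), hdet, hquad,
      trace_eq_zero_of_blkIdx hblk]
    ring_nf
  · have ht' : ¬ 0 < r ^ 2 * z.2 := by
      rw [mul_pos_iff_of_pos_left (by positivity)]
      exact ht
    rw [hdil, fundSol, fundSol, if_neg ht, if_neg ht', mul_zero]
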